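/- Let K be a ring and K[t] the polynomial ring over K in one central indeterminate. Let C⁺ be a bounded chain complex of finitely generated projective K[t]-modules. If C⁺, regarded as a chain complex of K-modules by restriction of scalars along the constants inclusion K → K[t], is K-finitely dominated, then C⁺ is homotopy equivalent, as a chain complex of K[t]-modules, to a bounded chain complex of finitely generated free K[t]-modules. -/

import Mathlib

open CategoryTheory

universe u

/-- A `ℤ`-indexed chain complex `C` of `K`-modules is `K`-finitely dominated if there
are a bounded chain complex `D` of finitely generated free `K`-modules and chain maps
`f : C → D`, `g : D → C` such that `g ∘ f` is chain homotopic to the identity of `C`. -/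
def IsFinitelyDominated (K : Type u) [Ring K] (C : ChainComplex (ModuleCat.{u} K) ℤ) : Prop :=
  ∃ (D : ChainComplex (ModuleCat.{u} K) ℤ) (f : C ⟶ D) (g : D ⟶ C),
    (∃ a b : ℤ, ∀ i : ℤ, (i < a ∨ b < i) → Limits.IsZero (D.X i)) ∧
    (∀ i : ℤ, Module.Finite K (D.X i) ∧ Module.Free K (D.X i)) ∧
    Nonempty (Homotopy (f ≫ g) (𝟙 C))

/-- Restriction of scalars along the constants inclusion `K → K[t]` for chain
complexes of `K[t]`-modules. -/
noncomputable def restrictToConstants {K : Type u} [Ring K]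
    (C : ChainComplex (ModuleCat.{u} (Polynomial K)) ℤ) :
    ChainComplex (ModuleCat.{u} K) ℤ :=
  ((ModuleCat.restrictScalars.{u} (Polynomial.C : K →+* Polynomial K)).mapHomologicalComplex
    (ComplexShape.down ℤ)).obj C

section Triangulated

open Pretriangulated Limits

variable {A : Type*} [Category* A] [Preadditive A] [HasZeroObject A] [HasShift A ℤ]
  [∀ n : ℤ, (shiftFunctor A n).Additive] [Pretriangulated A]

/-- An endomorphism of a distinguished triangle `X → X → Z → X⟦1⟧` whose first two components are
`𝟙 X - φ`, where `φ` is the first map of the triangle, is invertible on `Z`. -/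
theorem isIso_of_distinguished_of_id_sub {X Z : A} {φ : X ⟶ X} {i : X ⟶ Z} {p : Z ⟶ X⟦(1 : ℤ)⟧}
    (hT : Triangle.mk φ i p ∈ distTriang A) {θ : Z ⟶ Z}
    (hi : i ≫ θ = (𝟙 X - φ) ≫ i) (hp : p ≫ (𝟙 X - φ)⟦(1 : ℤ)⟧' = θ ≫ p) : IsIso θ := by
  have hφi : φ ≫ i = 0 := comp_distTriang_mor_zero₁₂ _ hT
  have hpφ : p ≫ φ⟦(1 : ℤ)⟧' = 0 := comp_distTriang_mor_zero₃₁ _ hT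
  have h₁ : i ≫ (𝟙 Z - θ) = 0 := by
    rw [Preadditive.comp_sub, hi, Preadditive.sub_comp, hφi]; simp
  have h₂ : (𝟙 Z - θ) ≫ p = 0 := by
    rw [Preadditive.sub_comp, ← hp, Functor.map_sub, Preadditive.comp_sub, hpφ]; simp
  obtain ⟨w, hw⟩ : ∃ w : X⟦(1 : ℤ)⟧ ⟶ Z, 𝟙 Z - θ = p ≫ w :=
    Triangle.yoneda_exact₃ _ hT (𝟙 Z - θ) h₁
  have h₃ : (𝟙 Z - θ) ≫ (𝟙 Z - θ) = 0 := by
    nth_rewrite 2 [hw]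
    rw [reassoc_of% h₂, zero_comp]
  have h₄ : θ ≫ (𝟙 Z + (𝟙 Z - θ)) = 𝟙 Z := by
    simp only [Preadditive.comp_sub, Preadditive.sub_comp, Preadditive.comp_add, Category.comp_id,
      Category.id_comp] at h₃ ⊢
    rw [← sub_eq_zero, ← neg_eq_zero, ← h₃]; abel
  have h₅ : (𝟙 Z + (𝟙 Z - θ)) ≫ θ = 𝟙 Z := by
    simp only [Preadditive.comp_sub, Preadditive.sub_comp, Preadditive.add_comp, Category.comp_id,
      Category.id_comp] at h₃ ⊢
    rw [← sub_eq_zero, ← neg_eq_zero, ← h₃]; abel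
  exact ⟨_, h₄, h₅⟩

/-- **Mather's trick**: the cones of `𝟙 - a ≫ b` and of `𝟙 - b ≫ a` are isomorphic. -/
theorem nonempty_iso_cone_id_sub_comp {X Y Z W : A} (a : X ⟶ Y) (b : Y ⟶ X)
    {i : X ⟶ Z} {p : Z ⟶ X⟦(1 : ℤ)⟧} {j : Y ⟶ W} {q : W ⟶ Y⟦(1 : ℤ)⟧}
    (hZ : Triangle.mk (𝟙 X - a ≫ b) i p ∈ distTriang A)
    (hW : Triangle.mk (𝟙 Y - b ≫ a) j q ∈ distTriang A) : Nonempty (Z ≅ W) := by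
  have h_ab : (𝟙 X - a ≫ b) ≫ a = a ≫ (𝟙 Y - b ≫ a) := by
    simp [Preadditive.comp_sub, Preadditive.sub_comp]
  have h_ba : (𝟙 Y - b ≫ a) ≫ b = b ≫ (𝟙 X - a ≫ b) := by
    simp [Preadditive.comp_sub, Preadditive.sub_comp]
  obtain ⟨α, hα₁, hα₂⟩ : ∃ α : Z ⟶ W, i ≫ α = a ≫ j ∧ p ≫ a⟦(1 : ℤ)⟧' = α ≫ q :=
    complete_distinguished_triangle_morphism _ _ hZ hW a a h_ab
  obtain ⟨β, hβ₁, hβ₂⟩ : ∃ β : W ⟶ Z, j ≫ β = b ≫ i ∧ q ≫ b⟦(1 : ℤ)⟧' = β ≫ p :=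
    complete_distinguished_triangle_morphism _ _ hW hZ b b h_ba
  have h₁ : IsIso (α ≫ β) := isIso_of_distinguished_of_id_sub hZ
    (by rw [reassoc_of% hα₁, hβ₁]; simp)
    (by simp only [sub_sub_cancel, Functor.map_comp, Category.assoc]
        rw [reassoc_of% hα₂, hβ₂])
  have h₂ : IsIso (β ≫ α) := isIso_of_distinguished_of_id_sub hW
    (by rw [reassoc_of% hβ₁, hα₁]; simp)
    (by simp only [sub_sub_cancel, Functor.map_comp, Category.assoc]
        rw [reassoc_of% hβ₂, hα₂])
  have h₃ : Mono α := mono_of_mono α β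
  have h₄ : IsSplitEpi α := ⟨⟨⟨inv (β ≫ α) ≫ β, by simp⟩⟩⟩
  have h₅ : IsIso α := isIso_of_mono_of_isSplitEpi α
  exact ⟨asIso α⟩

end Triangulated

section Complexes

open Limits Pretriangulated

variable {V : Type*} [Category* V] [Preadditive V] [HasZeroObject V] [HasBinaryBiproducts V]

/-- If `C` is the degreewise split cokernel of an endomorphism `T` of a complex `X` dominated by
`Y`, then `C` is homotopy equivalent to the mapping cone of an endomorphism of `Y`. -/
theorem CochainComplex.exists_homotopyEquiv_of_dominated
    {X Y C : CochainComplex V ℤ} (T : X ⟶ X) (ε : X ⟶ C) (w : T ≫ ε = 0)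
    (σ : ∀ n, ((ShortComplex.mk T ε w).map (HomologicalComplex.eval V _ n)).Splitting)
    (f : X ⟶ Y) (g : Y ⟶ X) (h : Homotopy (f ≫ g) (𝟙 X)) :
    ∃ D : CochainComplex V ℤ, (∀ i, Nonempty (D.X i ≅ Y.X (i + 1) ⊞ Y.X i)) ∧
      Nonempty (HomotopyEquiv C D) := by
  let Q := HomotopyCategory.quotient V (ComplexShape.up ℤ)
  have hfg : Q.map f ≫ Q.map g = 𝟙 _ := by
    rw [← Q.map_comp, ← Q.map_id]; exact HomotopyCategory.eq_of_homotopy _ _ h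
  have h₁ := (HomotopyCategory.distinguished_iff_iso_trianglehOfDegreewiseSplit _).2
    ⟨_, σ, ⟨Iso.refl _⟩⟩
  let E : Y ⟶ Y := 𝟙 Y - (g ≫ (𝟙 X - T)) ≫ f
  have h₂ := HomotopyCategory.mappingCone_triangleh_distinguished E
  have e₁ : Q.map T = 𝟙 _ - Q.map f ≫ Q.map (g ≫ (𝟙 X - T)) := by
    rw [Q.map_comp, reassoc_of% hfg]; simp
  have e₂ : Q.map E = 𝟙 _ - Q.map (g ≫ (𝟙 X - T)) ≫ Q.map f := by
    simp [E]
  obtain ⟨e⟩ := nonempty_iso_cone_id_sub_comp (Z := Q.obj C) (W := Q.obj (mappingCone E))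
    (Q.map f) (Q.map (g ≫ (𝟙 X - T)))
    (by rw [← e₁]; exact h₁) (by rw [← e₂]; exact h₂)
  refine ⟨mappingCone E, fun i => ⟨?_⟩, ⟨HomotopyCategory.homotopyEquivOfIso e⟩⟩
  exact HomologicalComplex.homotopyCofiber.XIsoBiprod E i (i + 1) rfl

/-- Restriction along a surjective embedding of complex shapes preserves homotopies. -/
noncomputable def Homotopy.restriction {ι ι' : Type*} {c : ComplexShape ι} {c' : ComplexShape ι'}
    {K L : HomologicalComplex V c'} {φ ψ : K ⟶ L} (h : Homotopy φ ψ) (e : c.Embedding c')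
    [e.IsRelIff] (he : Function.Surjective e.f) :
    Homotopy (HomologicalComplex.restrictionMap φ e) (HomologicalComplex.restrictionMap ψ e) where
  hom i j := h.hom (e.f i) (e.f j)
  zero i j hij := h.zero _ _ (by rwa [e.rel_iff])
  comm i := by
    let k : ∀ i j, (K.restriction e).X i ⟶ (L.restriction e).X j :=
      fun i j => h.hom (e.f i) (e.f j)
    have h₁ : dNext i k = dNext (e.f i) h.hom := by
      by_cases hi : ∃ j, c.Rel i j
      · obtain ⟨j, hj⟩ := hi
        exact (dNext_eq k hj).trans (dNext_eq h.hom ((e.rel_iff i j).2 hj)).symm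
      · have hn : ¬ ∃ j, c'.Rel (e.f i) j := by
          rintro ⟨j, hj⟩
          obtain ⟨j, rfl⟩ := he j
          exact hi ⟨j, (e.rel_iff i j).1 hj⟩
        refine Eq.trans (b := 0) ?_ (Eq.symm ?_)
        · exact (congrArg (· ≫ _) (HomologicalComplex.shape _ _ _ fun h => hi ⟨_, h⟩)).trans
            zero_comp
        · exact (congrArg (· ≫ _) (HomologicalComplex.shape _ _ _ fun h => hn ⟨_, h⟩)).trans
            zero_comp
    have h₂ : prevD i k = prevD (e.f i) h.hom := by
      by_cases hi : ∃ j, c.Rel j i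
      · obtain ⟨j, hj⟩ := hi
        exact (prevD_eq k hj).trans (prevD_eq h.hom ((e.rel_iff j i).2 hj)).symm
      · have hn : ¬ ∃ j, c'.Rel j (e.f i) := by
          rintro ⟨j, hj⟩
          obtain ⟨j, rfl⟩ := he j
          exact hi ⟨j, (e.rel_iff j i).1 hj⟩
        refine Eq.trans (b := 0) ?_ (Eq.symm ?_)
        · exact (congrArg (_ ≫ ·) (HomologicalComplex.shape _ _ _ fun h => hi ⟨_, h⟩)).trans
            comp_zero
        · exact (congrArg (_ ≫ ·) (HomologicalComplex.shape _ _ _ fun h => hn ⟨_, h⟩)).trans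
            comp_zero
    exact (h.comm (e.f i)).trans (congrArg₂ (fun x y => x + y + ψ.f (e.f i)) h₁.symm h₂.symm)

/-- Restriction along a surjective embedding of complex shapes preserves homotopy equivalences. -/
noncomputable def HomotopyEquiv.restriction {ι ι' : Type*} {c : ComplexShape ι}
    {c' : ComplexShape ι'} {K L : HomologicalComplex V c'} (h : HomotopyEquiv K L)
    (e : c.Embedding c') [e.IsRelIff] (he : Function.Surjective e.f) :
    HomotopyEquiv (K.restriction e) (L.restriction e) where
  hom := HomologicalComplex.restrictionMap h.hom e
  inv := HomologicalComplex.restrictionMap h.inv e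
  homotopyHomInvId := h.homotopyHomInvId.restriction e he
  homotopyInvHomId := h.homotopyInvHomId.restriction e he

/-- If `C` is the degreewise split cokernel of an endomorphism of a chain complex dominated by
`Y`, then `C` is homotopy equivalent to a complex with terms `Y.X (i - 1) ⊞ Y.X i`. -/
theorem ChainComplex.exists_homotopyEquiv_of_dominated
    {X Y C : ChainComplex V ℤ} (T : X ⟶ X) (ε : X ⟶ C) (w : T ≫ ε = 0)
    (σ : ∀ n, ((ShortComplex.mk T ε w).map (HomologicalComplex.eval V _ n)).Splitting)
    (f : X ⟶ Y) (g : Y ⟶ X) (h : Homotopy (f ≫ g) (𝟙 X)) :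
    ∃ D : ChainComplex V ℤ, (∀ i, Nonempty (D.X i ≅ Y.X (i - 1) ⊞ Y.X i)) ∧
      Nonempty (HomotopyEquiv C D) := by
  let e := ComplexShape.embeddingUpIntDownInt
  let e' := ComplexShape.embeddingDownIntUpInt
  obtain ⟨D, hD, ⟨H⟩⟩ := CochainComplex.exists_homotopyEquiv_of_dominated
    (HomologicalComplex.restrictionMap T e) (HomologicalComplex.restrictionMap ε e)
    (by rw [← HomologicalComplex.restrictionMap_comp, w]; rfl)
    (fun n => σ (-n)) (HomologicalComplex.restrictionMap f e)
    (HomologicalComplex.restrictionMap g e) (h.restriction e neg_surjective)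
  refine ⟨D.restriction e', fun i => ?_,
    ⟨(HomotopyEquiv.ofIso ((ChainComplex.cochainComplexEquivalence V).unitIso.app C)).trans
      (H.restriction e' neg_surjective)⟩⟩
  obtain ⟨E⟩ := hD (-i)
  exact ⟨E ≪≫ biprod.mapIso (Y.XIsoOfEq (show -(-i + 1) = i - 1 by ring))
    (Y.XIsoOfEq (neg_neg i))⟩

end Complexes

section PolynomialExtension

open Polynomial

/-- The underlying additive group of the extension of scalars `K[t] ⊗ M` of a `K`-module `M`:
polynomials with coefficients in `M`. -/
def PolynomialExtension (K M : Type*) [Ring K] [AddCommGroup M] [Module K M] : Type _ := ℕ →₀ M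

namespace PolynomialExtension

variable {K M N : Type*} [Ring K] [AddCommGroup M] [Module K M]

noncomputable instance : AddCommGroup (PolynomialExtension K M) :=
  inferInstanceAs (AddCommGroup (ℕ →₀ M))

/-- The coefficients of a polynomial with coefficients in `M`. -/
def coeff (x : PolynomialExtension K M) (n : ℕ) : M := (show ℕ →₀ M from x) n

variable (K) in
/-- The monomial `m tⁿ`. -/
noncomputable def monomial (n : ℕ) : M →+ PolynomialExtension K M := Finsupp.singleAddHom n

@[ext]
theorem ext {x y : PolynomialExtension K M} (h : ∀ n, x.coeff n = y.coeff n) : x = y :=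
  Finsupp.ext h

@[simp] theorem coeff_zero (n : ℕ) : (0 : PolynomialExtension K M).coeff n = 0 := rfl

@[simp] theorem coeff_add (x y : PolynomialExtension K M) (n : ℕ) :
    (x + y).coeff n = x.coeff n + y.coeff n := rfl

@[simp] theorem coeff_sub (x y : PolynomialExtension K M) (n : ℕ) :
    (x - y).coeff n = x.coeff n - y.coeff n := rfl

theorem coeff_monomial (n k : ℕ) (m : M) :
    (monomial K n m).coeff k = if n = k then m else 0 :=
  Finsupp.single_apply

theorem exists_coeff_eq_zero (x : PolynomialExtension K M) : ∃ n, ∀ k, n ≤ k → x.coeff k = 0 := by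
  obtain ⟨n, hn⟩ := (show ℕ →₀ M from x).support.bddAbove
  refine ⟨n + 1, fun k hk => by_contra fun h => ?_⟩
  exact absurd (hn (Finsupp.mem_support_iff.2 h)) (by omega)

@[elab_as_elim]
theorem induction {P : PolynomialExtension K M → Prop} (x : PolynomialExtension K M)
    (zero : P 0) (add : ∀ x y, P x → P y → P (x + y)) (mono : ∀ n m, P (monomial K n m)) : P x :=
  Finsupp.induction_linear (show ℕ →₀ M from x) zero add mono

theorem addHom_ext {A : Type*} [AddCommGroup A] {f g : PolynomialExtension K M →+ A}
    (h : ∀ n m, f (monomial K n m) = g (monomial K n m)) : f = g :=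
  Finsupp.addHom_ext h

variable (K M) in
/-- Multiplication by scalars, coefficientwise. -/
noncomputable def scalar : K →+* AddMonoid.End (PolynomialExtension K M) :=
  Module.toAddMonoidEnd K (ℕ →₀ M)

variable (K M) in
/-- Multiplication by the variable. -/
noncomputable def shift : AddMonoid.End (PolynomialExtension K M) :=
  Finsupp.mapDomain.addMonoidHom (M := M) (· + 1)

theorem scalar_monomial (a : K) (n : ℕ) (m : M) :
    scalar K M a (monomial K n m) = monomial K n (a • m) :=
  Finsupp.smul_single _ _ _

theorem shift_monomial (n : ℕ) (m : M) :
    shift K M (monomial K n m) = monomial K (n + 1) m :=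
  Finsupp.mapDomain_single

theorem commute_scalar_shift (a : K) : Commute (scalar K M a) (shift K M) :=
  addHom_ext fun n m => by
    change scalar K M a (shift K M _) = shift K M (scalar K M a _)
    simp only [scalar_monomial, shift_monomial]

noncomputable instance : Module K[X] (PolynomialExtension K M) :=
  Module.compHom _ (eval₂RingHom' (scalar K M) (shift K M) commute_scalar_shift)

theorem smul_def (p : K[X]) (x : PolynomialExtension K M) :
    p • x = eval₂ (scalar K M) (shift K M) p x := rfl

@[simp] theorem C_smul_monomial (a : K) (n : ℕ) (m : M) :
    (C a : K[X]) • monomial K n m = monomial K n (a • m) := by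
  rw [smul_def, eval₂_C, scalar_monomial]

@[simp] theorem X_smul_monomial (n : ℕ) (m : M) :
    (X : K[X]) • monomial K n m = monomial K (n + 1) m := by
  rw [smul_def, eval₂_X, shift_monomial]

@[simp] theorem X_pow_smul_monomial (k n : ℕ) (m : M) :
    (X ^ k : K[X]) • monomial K n m = monomial K (n + k) m := by
  induction k with
  | zero => simp
  | succ k ih => rw [pow_succ', mul_smul, ih, X_smul_monomial, add_assoc]

variable [AddCommGroup N] [Module K[X] N]

theorem linearMap_ext {f g : PolynomialExtension K M →ₗ[K[X]] N}
    (h : ∀ m, f (monomial K 0 m) = g (monomial K 0 m)) : f = g := by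
  ext x
  induction x using induction with
  | zero => simp
  | add x y hx hy => simp [hx, hy]
  | mono n m =>
    have : monomial K n m = (X ^ n : K[X]) • monomial K 0 m := by simp
    rw [this, map_smul, map_smul, h]

/-- A map from `M` to a `K[t]`-module `N` which is linear over the constants extends to a
`K[t]`-linear map on polynomials with coefficients in `M`. -/
noncomputable def lift (φ : M →+ N) (hφ : ∀ (a : K) m, φ (a • m) = (C a : K[X]) • φ m) :
    PolynomialExtension K M →ₗ[K[X]] N :=
  let F : PolynomialExtension K M →+ N :=
    Finsupp.liftAddHom fun n => (DistribSMul.toAddMonoidHom N (X ^ n : K[X])).comp φ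
  have hF (n m) : F (monomial K n m) = (X ^ n : K[X]) • φ m :=
    Finsupp.liftAddHom_apply_single _ _ _
  { F with
    map_smul' := fun p x => by
      change F (p • x) = p • F x
      induction x using induction with
      | zero => simp
      | add x y hx hy => rw [smul_add, map_add, hx, hy, map_add, smul_add]
      | mono n m =>
        induction p using Polynomial.induction_on' with
        | add p q hp hq => rw [add_smul, map_add, hp, hq, add_smul]
        | monomial k a =>
          rw [← C_mul_X_pow_eq_monomial, mul_smul, X_pow_smul_monomial, C_smul_monomial, hF, hF,
            hφ, ← mul_smul, ← mul_smul, X_pow_mul_C, mul_assoc, ← pow_add, add_comm n k] }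

@[simp] theorem lift_monomial (φ : M →+ N) (hφ : ∀ (a : K) m, φ (a • m) = (C a : K[X]) • φ m)
    (n : ℕ) (m : M) : lift φ hφ (monomial K n m) = (X ^ n : K[X]) • φ m :=
  Finsupp.liftAddHom_apply_single _ _ _

variable {M' : Type*} [AddCommGroup M'] [Module K M']

/-- The map induced on polynomials by a linear map on coefficients. -/
noncomputable def map (φ : M →ₗ[K] M') :
    PolynomialExtension K M →ₗ[K[X]] PolynomialExtension K M' :=
  lift ((monomial K 0).comp φ.toAddMonoidHom) (by simp)

@[simp] theorem map_monomial (φ : M →ₗ[K] M') (n : ℕ) (m : M) :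
    map φ (monomial K n m) = monomial K n (φ m) := by
  simp [map]

/-- The extension of scalars of a free module is free on the same basis. -/
noncomputable def equivFinsupp (ι : Type*) :
    PolynomialExtension K (ι →₀ K) ≃ₗ[K[X]] (ι →₀ K[X]) :=
  LinearEquiv.ofLinearMap
    (lift (Finsupp.mapRange.addMonoidHom (C : K →+* K[X]).toAddMonoidHom)
      (fun a m => by ext; simp))
    (Finsupp.lsum ℕ fun i => LinearMap.toSpanSingleton K[X] _ (monomial K 0 (Finsupp.single i 1)))
    (by ext; simp)
    (linearMap_ext fun m => by
      induction m using Finsupp.induction_linear with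
      | zero => simp
      | add x y hx hy => simp only [map_add, hx, hy]
      | single i a => simp)

/-- The equivalence induced on polynomials by a linear equivalence on coefficients. -/
noncomputable def mapEquiv (e : M ≃ₗ[K] M') :
    PolynomialExtension K M ≃ₗ[K[X]] PolynomialExtension K M' :=
  LinearEquiv.ofLinearMap (map e.toLinearMap) (map e.symm.toLinearMap)
    (linearMap_ext fun m => by simp) (linearMap_ext fun m => by simp)

instance [Module.Free K M] : Module.Free K[X] (PolynomialExtension K M) :=
  Module.Free.of_equiv
    ((mapEquiv (Module.Free.chooseBasis K M).repr).trans (equivFinsupp _)).symm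

instance [Module.Finite K M] [Module.Free K M] :
    Module.Finite K[X] (PolynomialExtension K M) :=
  Module.Finite.equiv
    ((mapEquiv (Module.Free.chooseBasis K M).repr).trans (equivFinsupp _)).symm

section Characteristic

variable [Module K N] [IsScalarTower K K[X] N]

theorem C_smul_eq (a : K) (n : N) : (C a : K[X]) • n = a • n := by
  rw [← mul_one (C a), ← smul_eq_C_mul, smul_assoc, one_smul]

theorem X_smul_smul (a : K) (n : N) : (X : K[X]) • a • n = a • (X : K[X]) • n := by
  rw [← C_smul_eq a n, ← C_smul_eq a, ← mul_smul, ← mul_smul, X_mul]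

variable (K N)

/-- The evaluation map `n tⁱ ↦ tⁱ • n`. -/
noncomputable def eval : PolynomialExtension K N →ₗ[K[X]] N :=
  lift (AddMonoidHom.id N) fun a n => (C_smul_eq a n).symm

/-- The endomorphism `t ⊗ 1 - 1 ⊗ t` of `K[t] ⊗ N`. -/
noncomputable def characteristic : PolynomialExtension K N →ₗ[K[X]] PolynomialExtension K N :=
  lift (monomial K 1 - (monomial K 0).comp (DistribSMul.toAddMonoidHom N (X : K[X])))
    fun a n => by simp [smul_sub, X_smul_smul]

variable {K N}

@[simp] theorem eval_monomial (i : ℕ) (n : N) :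
    eval K N (monomial K i n) = (X ^ i : K[X]) • n := by
  simp [eval]

@[simp] theorem characteristic_monomial (i : ℕ) (n : N) :
    characteristic K N (monomial K i n) =
      monomial K (i + 1) n - monomial K i ((X : K[X]) • n) := by
  simp [characteristic, smul_sub, add_comm]

theorem eval_characteristic (x : PolynomialExtension K N) :
    eval K N (characteristic K N x) = 0 := by
  induction x using induction with
  | zero => simp
  | add x y hx hy => simp [hx, hy]
  | mono n m => simp [pow_succ, mul_smul]

theorem coeff_characteristic (x : PolynomialExtension K N) (i : ℕ) :
    (characteristic K N x).coeff (i + 1) = x.coeff i - (X : K[X]) • x.coeff (i + 1) := by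
  induction x using induction with
  | zero => simp
  | add x y hx hy => simp [hx, hy]; abel
  | mono n m => simp [coeff_monomial, smul_ite]

theorem characteristic_injective : Function.Injective (characteristic K N) := by
  rw [injective_iff_map_eq_zero]
  intro x hx
  have h (i : ℕ) : x.coeff i = (X : K[X]) • x.coeff (i + 1) := by
    rw [← sub_eq_zero, ← coeff_characteristic, hx, coeff_zero]
  obtain ⟨n, hn⟩ := x.exists_coeff_eq_zero
  have key (k : ℕ) : ∀ i, n ≤ i + k → x.coeff i = 0 := by
    induction k with
    | zero => exact hn
    | succ k ih => exact fun i hi => by rw [h, ih (i + 1) (by omega), smul_zero]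
  ext i
  exact key n i (by omega)

theorem eval_surjective : Function.Surjective (eval K N) := fun n =>
  ⟨monomial K 0 n, by simp⟩

theorem exists_characteristic_eq (x : PolynomialExtension K N) :
    ∃ y, characteristic K N y = x - monomial K 0 (eval K N x) := by
  change x - monomial K 0 (eval K N x) ∈ LinearMap.range (characteristic K N)
  induction x using induction with
  | zero => simp
  | add x y hx hy =>
    convert add_mem hx hy using 1
    simp; abel
  | mono n m =>
    induction n generalizing m with
    | zero => simp
    | succ n ih =>
      convert add_mem (ih ((X : K[X]) • m))
        (LinearMap.mem_range_self (characteristic K N) (monomial K n m)) using 1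
      simp [pow_succ, mul_smul]

theorem exact_characteristic_eval :
    Function.Exact (characteristic K N) (eval K N) := fun x =>
  ⟨fun hx => by simpa [hx] using exists_characteristic_eq x,
    by rintro ⟨y, rfl⟩; exact eval_characteristic y⟩

variable {N' : Type*} [AddCommGroup N'] [Module K[X] N'] [Module K N'] [IsScalarTower K K[X] N']

theorem eval_map (φ : N →ₗ[K[X]] N') (φ' : N →ₗ[K] N') (h : ∀ n, φ' n = φ n) :
    (eval K N').comp (map φ') = φ.comp (eval K N) :=
  linearMap_ext fun n => by simp [h]

theorem characteristic_map (φ : N →ₗ[K[X]] N') (φ' : N →ₗ[K] N') (h : ∀ n, φ' n = φ n) :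
    (characteristic K N').comp (map φ') = (map φ').comp (characteristic K N) :=
  linearMap_ext fun n => by simp [h]

end Characteristic

end PolynomialExtension
end PolynomialExtension

section ModuleCategories

open Polynomial PolynomialExtension

variable {K : Type u} [Ring K]

/-- Extension of scalars along the constants inclusion `K → K[t]`. -/
noncomputable def polynomialExtensionFunctor (K : Type u) [Ring K] :
    ModuleCat.{u} K ⥤ ModuleCat.{u} K[X] where
  obj M := ModuleCat.of K[X] (PolynomialExtension K M)
  map φ := ModuleCat.ofHom (PolynomialExtension.map φ.hom)
  map_id _ := ModuleCat.hom_ext (linearMap_ext fun m => by simp)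
  map_comp _ _ := ModuleCat.hom_ext (linearMap_ext fun m => by simp)

instance : (polynomialExtensionFunctor K).Additive where
  map_add {_ _ f g} := ModuleCat.hom_ext (linearMap_ext fun m => by
    change PolynomialExtension.map (f.hom + g.hom) _ =
      PolynomialExtension.map f.hom _ + PolynomialExtension.map g.hom _
    simp)

section

variable (N : ModuleCat.{u} K[X])

noncomputable instance : Module K[X] ((ModuleCat.restrictScalars (C : K →+* K[X])).obj N) :=
  inferInstanceAs (Module K[X] N)

instance : IsScalarTower K K[X] ((ModuleCat.restrictScalars (C : K →+* K[X])).obj N) where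
  smul_assoc a p n := by
    rw [smul_eq_C_mul]
    exact mul_smul (C a) p (show N from n)

end

/-- A `K[t]`-linear map, seen as a map between the underlying `K`-modules, which still carry
their action of `K[t]`. -/
noncomputable def restrictScalarsLinearMap {N N' : ModuleCat.{u} K[X]} (φ : N ⟶ N') :
    (ModuleCat.restrictScalars (C : K →+* K[X])).obj N →ₗ[K[X]]
      (ModuleCat.restrictScalars (C : K →+* K[X])).obj N' :=
  φ.hom

/-- The chain map given in each degree by `PolynomialExtension.characteristic`. -/
noncomputable def characteristicHom (N : ChainComplex (ModuleCat.{u} K[X]) ℤ) :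
    ((polynomialExtensionFunctor K).mapHomologicalComplex _).obj (restrictToConstants N) ⟶
      ((polynomialExtensionFunctor K).mapHomologicalComplex _).obj (restrictToConstants N) where
  f i := ModuleCat.ofHom (characteristic K ((ModuleCat.restrictScalars C).obj (N.X i)))
  comm' i j _ := ModuleCat.hom_ext (characteristic_map
    (restrictScalarsLinearMap (N.d i j))
    ((ModuleCat.restrictScalars C).map (N.d i j)).hom fun _ => rfl).symm

/-- The chain map given in each degree by `PolynomialExtension.eval`. -/
noncomputable def evalHom (N : ChainComplex (ModuleCat.{u} K[X]) ℤ) :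
    ((polynomialExtensionFunctor K).mapHomologicalComplex _).obj (restrictToConstants N) ⟶ N where
  f i := ModuleCat.ofHom (PolynomialExtension.eval K ((ModuleCat.restrictScalars C).obj (N.X i)))
  comm' i j _ := ModuleCat.hom_ext (PolynomialExtension.eval_map
    (restrictScalarsLinearMap (N.d i j))
    ((ModuleCat.restrictScalars C).map (N.d i j)).hom fun _ => rfl).symm

theorem characteristicHom_evalHom (N : ChainComplex (ModuleCat.{u} K[X]) ℤ) :
    characteristicHom N ≫ evalHom N = 0 := by
  ext i : 2
  exact LinearMap.ext (eval_characteristic (N := (ModuleCat.restrictScalars C).obj (N.X i)))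

theorem shortExact_characteristicHom_evalHom (N : ChainComplex (ModuleCat.{u} K[X]) ℤ) (i : ℤ) :
    ((ShortComplex.mk _ _ (characteristicHom_evalHom N)).map
      (HomologicalComplex.eval _ _ i)).ShortExact where
  exact := (ShortComplex.ShortExact.moduleCat_exact_iff_function_exact _).2
    (exact_characteristic_eval (N := (ModuleCat.restrictScalars C).obj (N.X i)))
  mono_f := (ModuleCat.mono_iff_injective _).2
    (characteristic_injective (N := (ModuleCat.restrictScalars C).obj (N.X i)))
  epi_g := (ModuleCat.epi_iff_surjective _).2
    (PolynomialExtension.eval_surjective (N := (ModuleCat.restrictScalars C).obj (N.X i)))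

/-- A degreewise splitting of the characteristic sequence of a complex of projectives. -/
noncomputable def splittingCharacteristicHomEvalHom (N : ChainComplex (ModuleCat.{u} K[X]) ℤ)
    (i : ℤ) (h : Projective (N.X i)) :
    ((ShortComplex.mk _ _ (characteristicHom_evalHom N)).map
      (HomologicalComplex.eval _ _ i)).Splitting :=
  have : Projective ((ShortComplex.mk _ _ (characteristicHom_evalHom N)).map
      (HomologicalComplex.eval _ _ i)).X₃ := h
  (shortExact_characteristicHom_evalHom N i).splittingOfProjective

end ModuleCategories

/-- **Proposition.**  Let `K` be a ring and `C⁺` a bounded complex of finitely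
generated projective `K[t]`-modules.  If `C⁺` is `K`-finitely dominated after
restriction of scalars along the constants inclusion `K → K[t]`, then `C⁺` is
homotopy equivalent, as a complex of `K[t]`-modules, to a bounded complex of finitely
generated free `K[t]`-modules. -/
theorem polynomial_fd_implies_homotopy_finite {K : Type u} [Ring K]
    (C : ChainComplex (ModuleCat.{u} (Polynomial K)) ℤ)
    (hbdd : ∃ a b : ℤ, ∀ i : ℤ, (i < a ∨ b < i) → Limits.IsZero (C.X i))
    (hfgproj : ∀ i : ℤ, Module.Finite (Polynomial K) (C.X i) ∧
      Module.Projective (Polynomial K) (C.X i))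
    (hfd : IsFinitelyDominated K (restrictToConstants C)) :
    ∃ D : ChainComplex (ModuleCat.{u} (Polynomial K)) ℤ,
      (∃ a b : ℤ, ∀ i : ℤ, (i < a ∨ b < i) → Limits.IsZero (D.X i)) ∧
      (∀ i : ℤ, Module.Finite (Polynomial K) (D.X i) ∧ Module.Free (Polynomial K) (D.X i)) ∧
      Nonempty (HomotopyEquiv C D) := by
  obtain ⟨Y, f, g, ⟨a, b, hab⟩, hY, ⟨h⟩⟩ := hfd
  let F := polynomialExtensionFunctor K
  have hproj (i : ℤ) : Projective (C.X i) :=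
    have := (hfgproj i).2
    ModuleCat.projective_of_categoryTheory_projective _
  obtain ⟨D, hD, hCD⟩ := ChainComplex.exists_homotopyEquiv_of_dominated
    (characteristicHom C) (evalHom C) (characteristicHom_evalHom C)
    (fun i => splittingCharacteristicHomEvalHom C i (hproj i))
    ((F.mapHomologicalComplex _).map f) ((F.mapHomologicalComplex _).map g)
    ((Homotopy.ofEq (Functor.map_comp _ _ _).symm).trans
      ((F.mapHomotopy h).trans (Homotopy.ofEq (CategoryTheory.Functor.map_id _ _))))
  refine ⟨D, ⟨a, b + 1, fun i hi => ?_⟩, fun i => ?_, hCD⟩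
  · obtain ⟨e⟩ := hD i
    have h₁ : Limits.IsZero (F.obj (Y.X (i - 1))) := F.map_isZero (hab _ (by omega))
    have h₂ : Limits.IsZero (F.obj (Y.X i)) := F.map_isZero (hab _ (by omega))
    exact ((Limits.biprod_isZero_iff _ _).2 ⟨h₁, h₂⟩).of_iso e
  · obtain ⟨e⟩ := hD i
    have := (hY i).1
    have := (hY i).2
    have := (hY (i - 1)).1
    have := (hY (i - 1)).2
    have E : (PolynomialExtension K (Y.X (i - 1)) × PolynomialExtension K (Y.X i)) ≃ₗ[Polynomial K]
        D.X i := (e ≪≫ ModuleCat.biprodIsoProd _ _).symm.toLinearEquiv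
    exact ⟨Module.Finite.equiv E, Module.Free.of_equiv E⟩
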